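/- For each n ∈ ℕ there exists m ∈ ℕ such that for every q ∈ (0, 1/2] and every set V ⊆ [1/2, 2]^n that is an intersection of finitely many sets of the form {x ∈ [1/2, 2]^n : (x_{i₁}, x_{i₂}, x_{i₃}, x_{i₄}) ∈ c} with c ∈ 𝒞(q) and i₁, i₂, i₃, i₄ ∈ {1, …, n}, there exists a set V′ ⊆ ℝ^{n+m} that is the intersection of finitely many sets of the forms {α : αᵢ + αⱼ = α_k}, {α : (1 + αᵢ)(1 + αⱼ) = 1 + α_k}, and {α : αᵢ = q}, with exactly one set of the last form, such that: (i) for every x ∈ V there exists y ∈ [−6q, 6q]^m with (q·x, y) ∈ V′; and (ii) for every (x, y) ∈ V′ with x ∈ ℝ^n and y ∈ ℝ^m, one has q^{−1}·x ∈ V. -/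

import Mathlib

/-- The collection `𝒞(q)` of constraint subsets of `[1/2, 2]^4` (coordinates
`(x, y, z, w) = (v 0, v 1, v 2, v 3)`): `x = y`, `x = (1+q)y`, `x + y = z`,
`x + y = z + w`, `x·y = z`, `x·y = z·w`, and the null constraint. -/
def CqSets (q : ℝ) : Set (Set (Fin 4 → ℝ)) :=
  { {v | (∀ i, v i ∈ Set.Icc (1/2 : ℝ) 2) ∧ v 0 = v 1},
    {v | (∀ i, v i ∈ Set.Icc (1/2 : ℝ) 2) ∧ v 0 = (1 + q) * v 1},
    {v | (∀ i, v i ∈ Set.Icc (1/2 : ℝ) 2) ∧ v 0 + v 1 = v 2},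
    {v | (∀ i, v i ∈ Set.Icc (1/2 : ℝ) 2) ∧ v 0 + v 1 = v 2 + v 3},
    {v | (∀ i, v i ∈ Set.Icc (1/2 : ℝ) 2) ∧ v 0 * v 1 = v 2},
    {v | (∀ i, v i ∈ Set.Icc (1/2 : ℝ) 2) ∧ v 0 * v 1 = v 2 * v 3},
    {v | ∀ i, v i ∈ Set.Icc (1/2 : ℝ) 2} }

/-- A "shrunk" constraint over an index type `ι`: `αᵢ = q`, `αᵢ + αⱼ = α_k`, or
`(1 + αᵢ)(1 + αⱼ) = 1 + α_k`. -/
inductive Shrunk (ι : Type) : Type where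
  | const : ι → Shrunk ι
  | add : ι → ι → ι → Shrunk ι
  | mul : ι → ι → ι → Shrunk ι

/-- Satisfaction of a shrunk constraint. -/
def Shrunk.Sat {ι : Type} (q : ℝ) (α : ι → ℝ) : Shrunk ι → Prop
  | .const i => α i = q
  | .add i j k => α i + α j = α k
  | .mul i j k => (1 + α i) * (1 + α j) = 1 + α k

def Shrunk.isConst {ι : Type} : Shrunk ι → Bool
  | .const _ => true
  | _ => false

/-- Reindexing of a shrunk constraint. -/
def Shrunk.map {ι κ : Type} (f : ι → κ) : Shrunk ι → Shrunk κ
  | .const i => .const (f i)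
  | .add i j k => .add (f i) (f j) (f k)
  | .mul i j k => .mul (f i) (f j) (f k)

theorem Shrunk.sat_map {ι κ : Type} (f : ι → κ) (q : ℝ) (α : κ → ℝ) (c : Shrunk ι) :
    (c.map f).Sat q α ↔ c.Sat q (α ∘ f) := by
  cases c <;> rfl

theorem Shrunk.isConst_map {ι κ : Type} (f : ι → κ) (c : Shrunk ι) :
    (c.map f).isConst = c.isConst := by
  cases c <;> rfl

/-- Auxiliary variables of size at most `2q`: the constants `0`, `q`, `q/2`, `2q`, the slacks of
the bounds `q/2 ≤ αᵢ ≤ 2q`, and square roots of `q` times these slacks. -/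
inductive ShrunkAtom (n : ℕ) : Type where
  | zero : ShrunkAtom n
  | unit : ShrunkAtom n
  | half : ShrunkAtom n
  | double : ShrunkAtom n
  | lower : Fin n → ShrunkAtom n
  | upper : Fin n → ShrunkAtom n
  | sqrtLower : Fin n → ShrunkAtom n
  | sqrtUpper : Fin n → ShrunkAtom n
  deriving Fintype

/-- The original variables together with the atoms. -/
abbrev ShrunkOperand (n : ℕ) : Type := Fin n ⊕ ShrunkAtom n

/-- All auxiliary variables: the atoms and, for each pair of operands `a, b`, variables standing
for `a + b`, `(1 + a)(1 + b) - 1` and `a * b`. -/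
inductive ShrunkAux (n : ℕ) : Type where
  | atom : ShrunkAtom n → ShrunkAux n
  | sum : ShrunkOperand n → ShrunkOperand n → ShrunkAux n
  | shift : ShrunkOperand n → ShrunkOperand n → ShrunkAux n
  | prod : ShrunkOperand n → ShrunkOperand n → ShrunkAux n
  deriving Fintype

namespace ShrunkAux

variable {n : ℕ}

/-- An operand as a variable. -/
def ofOperand : ShrunkOperand n → Fin n ⊕ ShrunkAux n := Sum.map id atom

/-- An atom as an operand. -/
abbrev op (a : ShrunkAtom n) : ShrunkOperand n := Sum.inr a

/-- An atom as a variable. -/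
abbrev var (a : ShrunkAtom n) : Fin n ⊕ ShrunkAux n := Sum.inr (atom a)

/-- The constraints, other than `αᵢ = q`, that define the auxiliary variables. -/
noncomputable def baseConstraints (n : ℕ) : List (Shrunk (Fin n ⊕ ShrunkAux n)) :=
  [.add (var .zero) (var .zero) (var .zero), .add (var .half) (var .half) (var .unit),
    .add (var .unit) (var .unit) (var .double)] ++
  (List.finRange n).flatMap (fun i =>
    [.add (var .half) (var (.lower i)) (.inl i), .add (.inl i) (var (.upper i)) (var .double),
      .add (.inr (prod (op (.sqrtLower i)) (op (.sqrtLower i)))) (var .zero)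
        (.inr (prod (op .unit) (op (.lower i)))),
      .add (.inr (prod (op (.sqrtUpper i)) (op (.sqrtUpper i)))) (var .zero)
        (.inr (prod (op .unit) (op (.upper i))))]) ++
  (Finset.univ.toList : List (ShrunkOperand n × ShrunkOperand n)).flatMap (fun p =>
    [.add (ofOperand p.1) (ofOperand p.2) (.inr (sum p.1 p.2)),
      .mul (ofOperand p.1) (ofOperand p.2) (.inr (shift p.1 p.2)),
      .add (.inr (sum p.1 p.2)) (.inr (prod p.1 p.2)) (.inr (shift p.1 p.2))])

theorem isConst_of_mem_baseConstraints {c : Shrunk (Fin n ⊕ ShrunkAux n)}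
    (hc : c ∈ baseConstraints n) : c.isConst = false := by
  simp only [baseConstraints, List.mem_append, List.mem_flatMap, List.mem_cons,
    List.not_mem_nil, or_false] at hc
  obtain ((rfl | rfl | rfl) | ⟨i, -, rfl | rfl | rfl | rfl⟩) | ⟨p, -, rfl | rfl | rfl⟩ := hc <;> rfl

/-- Assignments in which the auxiliary variables have their intended meaning. -/
structure Consistent (q : ℝ) (α : Fin n ⊕ ShrunkAux n → ℝ) : Prop where
  unit : α (var .unit) = q
  zero : α (var .zero) = 0
  half : α (var .half) = q / 2
  double : α (var .double) = 2 * q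
  lower : ∀ i, α (var (.lower i)) = α (.inl i) - q / 2
  upper : ∀ i, α (var (.upper i)) = 2 * q - α (.inl i)
  sqrtLower : ∀ i, α (var (.sqrtLower i)) ^ 2 = q * (α (.inl i) - q / 2)
  sqrtUpper : ∀ i, α (var (.sqrtUpper i)) ^ 2 = q * (2 * q - α (.inl i))
  sum : ∀ a b, α (.inr (.sum a b)) = α (ofOperand a) + α (ofOperand b)
  shift : ∀ a b, α (.inr (.shift a b)) =
    α (ofOperand a) + α (ofOperand b) + α (ofOperand a) * α (ofOperand b)
  prod : ∀ a b, α (.inr (.prod a b)) = α (ofOperand a) * α (ofOperand b)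

theorem consistent_iff (q : ℝ) (α : Fin n ⊕ ShrunkAux n → ℝ) :
    Consistent q α ↔ α (var .unit) = q ∧ ∀ c ∈ baseConstraints n, c.Sat q α := by
  have hbase : (∀ c ∈ baseConstraints n, c.Sat q α) ↔
      ((α (var .zero) + α (var .zero) = α (var .zero) ∧
        α (var .half) + α (var .half) = α (var .unit) ∧
        α (var .unit) + α (var .unit) = α (var .double)) ∧
      (∀ i, α (var .half) + α (var (.lower i)) = α (.inl i) ∧
        α (.inl i) + α (var (.upper i)) = α (var .double) ∧
        α (.inr (.prod (op (.sqrtLower i)) (op (.sqrtLower i)))) + α (var .zero) =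
          α (.inr (.prod (op .unit) (op (.lower i)))) ∧
        α (.inr (.prod (op (.sqrtUpper i)) (op (.sqrtUpper i)))) + α (var .zero) =
          α (.inr (.prod (op .unit) (op (.upper i)))))) ∧
      ∀ p : ShrunkOperand n × ShrunkOperand n,
        α (ofOperand p.1) + α (ofOperand p.2) = α (.inr (.sum p.1 p.2)) ∧
        (1 + α (ofOperand p.1)) * (1 + α (ofOperand p.2)) = 1 + α (.inr (.shift p.1 p.2)) ∧
        α (.inr (.sum p.1 p.2)) + α (.inr (.prod p.1 p.2)) = α (.inr (.shift p.1 p.2)) := by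
    simp only [baseConstraints, List.forall_mem_append, List.forall_mem_flatMap,
      List.forall_mem_cons, List.mem_finRange, Finset.mem_toList, Finset.mem_univ,
      List.not_mem_nil, false_imp_iff, implies_true, true_imp_iff, and_true, Shrunk.Sat]
  rw [hbase]
  constructor
  · intro h
    have hu := h.unit
    have hz := h.zero
    have hh := h.half
    have hd := h.double
    refine ⟨hu, ⟨⟨by linarith, by linarith, by linarith⟩, fun i => ?_⟩, fun p => ?_⟩
    · have hl := h.lower i
      have hr := h.upper i
      refine ⟨by linarith, by linarith, ?_, ?_⟩
      · rw [h.prod, h.prod]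
        change α (var _) * α (var _) + _ = α (var _) * α (var _)
        rw [hz, hu, hl, ← h.sqrtLower]
        ring
      · rw [h.prod, h.prod]
        change α (var _) * α (var _) + _ = α (var _) * α (var _)
        rw [hz, hu, hr, ← h.sqrtUpper]
        ring
    · rw [h.sum, h.shift, h.prod]
      refine ⟨rfl, by ring, rfl⟩
  · rintro ⟨hu, ⟨⟨hz, hh, hd⟩, hi⟩, hp⟩
    have hsum (a b) : α (.inr (.sum a b)) = α (ofOperand a) + α (ofOperand b) :=
      (hp (a, b)).1.symm
    have hprod (a b) : α (.inr (.prod a b)) = α (ofOperand a) * α (ofOperand b) := by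
      obtain ⟨h1, h2, h3⟩ := hp (a, b)
      dsimp only at h1 h2 h3
      linarith
    have hlow (i) : α (var (.lower i)) = α (.inl i) - q / 2 := by linarith [(hi i).1]
    have hupp (i) : α (var (.upper i)) = 2 * q - α (.inl i) := by linarith [(hi i).2.1]
    refine ⟨hu, by linarith, by linarith, by linarith, hlow, hupp, fun i => ?_, fun i => ?_,
      hsum, fun a b => ?_, hprod⟩
    · have h := (hi i).2.2.1
      rw [hprod, hprod] at h
      change α (var _) * α (var _) + _ = α (var _) * α (var _) at h
      rw [hu, hlow] at h
      linarith
    · have h := (hi i).2.2.2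
      rw [hprod, hprod] at h
      change α (var _) * α (var _) + _ = α (var _) * α (var _) at h
      rw [hu, hupp] at h
      linarith
    · linarith [(hp (a, b)).2.1]

theorem Consistent.mem_Icc {q : ℝ} (hq : 0 < q) {α : Fin n ⊕ ShrunkAux n → ℝ}
    (h : Consistent q α) (i : Fin n) : q⁻¹ * α (.inl i) ∈ Set.Icc (1 / 2 : ℝ) 2 := by
  have h1 : 0 ≤ α (.inl i) - q / 2 :=
    nonneg_of_mul_nonneg_right ((sq_nonneg _).trans_eq (h.sqrtLower i)) hq
  have h2 : 0 ≤ 2 * q - α (.inl i) :=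
    nonneg_of_mul_nonneg_right ((sq_nonneg _).trans_eq (h.sqrtUpper i)) hq
  rw [← div_eq_inv_mul, Set.mem_Icc, le_div_iff₀ hq, div_le_iff₀ hq]
  constructor <;> linarith

/-- Each constraint of `𝒞(q)` is equivalent, on consistent assignments, to a single additive
constraint. -/
theorem exists_shrunk_of_mem_CqSets {q : ℝ} (hq : 0 < q) (t : Fin 4 → Fin n)
    {s : Set (Fin 4 → ℝ)} (hs : s ∈ CqSets q) :
    ∃ c : Shrunk (Fin n ⊕ ShrunkAux n), c.isConst = false ∧ ∀ α, Consistent q α →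
      (c.Sat q α ↔ (fun k => q⁻¹ * α (.inl (t k))) ∈ s) := by
  have hq' := hq.ne'
  simp only [CqSets, Set.mem_insert_iff, Set.mem_singleton_iff] at hs
  rcases hs with rfl | rfl | rfl | rfl | rfl | rfl | rfl
  · refine ⟨.add (.inl (t 0)) (var .zero) (.inl (t 1)), rfl, fun α h => ?_⟩
    simp only [Set.mem_ofPred_eq, fun k => h.mem_Icc hq (t k), implies_true, true_and, Shrunk.Sat,
      h.zero]
    field_simp
    ring_nf
  · refine ⟨.add (.inl (t 1)) (.inr (prod (op .unit) (.inl (t 1)))) (.inl (t 0)), rfl,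
      fun α h => ?_⟩
    have hu : α (ofOperand (op .unit)) = q := h.unit
    have h1 : α (ofOperand (.inl (t 1))) = α (.inl (t 1)) := rfl
    simp only [Set.mem_ofPred_eq, fun k => h.mem_Icc hq (t k), implies_true, true_and, Shrunk.Sat,
      h.prod, hu, h1]
    field_simp
    constructor <;> intro h <;> linarith
  · refine ⟨.add (.inl (t 0)) (.inl (t 1)) (.inl (t 2)), rfl, fun α h => ?_⟩
    simp only [Set.mem_ofPred_eq, fun k => h.mem_Icc hq (t k), implies_true, true_and, Shrunk.Sat]
    field_simp
  · refine ⟨.add (.inr (sum (.inl (t 0)) (.inl (t 1)))) (var .zero)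
      (.inr (sum (.inl (t 2)) (.inl (t 3)))), rfl, fun α h => ?_⟩
    have hk (k) : α (ofOperand (.inl (t k))) = α (.inl (t k)) := rfl
    simp only [Set.mem_ofPred_eq, fun k => h.mem_Icc hq (t k), implies_true, true_and, Shrunk.Sat,
      h.sum, h.zero, hk, add_zero]
    field_simp
  · refine ⟨.add (.inr (prod (.inl (t 0)) (.inl (t 1)))) (var .zero)
      (.inr (prod (op .unit) (.inl (t 2)))), rfl, fun α h => ?_⟩
    have hu : α (ofOperand (op .unit)) = q := h.unit
    have hk (k) : α (ofOperand (.inl (t k))) = α (.inl (t k)) := rfl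
    simp only [Set.mem_ofPred_eq, fun k => h.mem_Icc hq (t k), implies_true, true_and, Shrunk.Sat,
      h.prod, h.zero, hk, hu, add_zero]
    field_simp
  · refine ⟨.add (.inr (prod (.inl (t 0)) (.inl (t 1)))) (var .zero)
      (.inr (prod (.inl (t 2)) (.inl (t 3)))), rfl, fun α h => ?_⟩
    have hk (k) : α (ofOperand (.inl (t k))) = α (.inl (t k)) := rfl
    simp only [Set.mem_ofPred_eq, fun k => h.mem_Icc hq (t k), implies_true, true_and, Shrunk.Sat,
      h.prod, h.zero, hk, add_zero]
    field_simp
  · refine ⟨.add (var .zero) (var .zero) (var .zero), rfl, fun α h => ?_⟩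
    simp only [Set.mem_ofPred_eq, fun k => h.mem_Icc hq (t k), implies_true, Shrunk.Sat, h.zero,
      add_zero]

/-- The intended values of the operands at the point `q * x`. -/
noncomputable def operandValue (q : ℝ) (x : Fin n → ℝ) : ShrunkOperand n → ℝ
  | .inl i => q * x i
  | .inr .zero => 0
  | .inr .unit => q
  | .inr .half => q / 2
  | .inr .double => 2 * q
  | .inr (.lower i) => q * x i - q / 2
  | .inr (.upper i) => 2 * q - q * x i
  | .inr (.sqrtLower i) => q * √(x i - 1 / 2)
  | .inr (.sqrtUpper i) => q * √(2 - x i)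

/-- The intended values of the auxiliary variables at the point `q * x`. -/
noncomputable def value (q : ℝ) (x : Fin n → ℝ) : ShrunkAux n → ℝ
  | .atom a => operandValue q x (.inr a)
  | .sum a b => operandValue q x a + operandValue q x b
  | .shift a b =>
    operandValue q x a + operandValue q x b + operandValue q x a * operandValue q x b
  | .prod a b => operandValue q x a * operandValue q x b

theorem abs_operandValue_le {q : ℝ} (hq : 0 < q) {x : Fin n → ℝ}
    (hx : ∀ i, x i ∈ Set.Icc (1 / 2 : ℝ) 2) (a : ShrunkOperand n) :
    |operandValue q x a| ≤ 2 * q := by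
  have hmul {s : ℝ} (h0 : 0 ≤ s) (h2 : s ≤ 2) : |q * s| ≤ 2 * q := by
    rw [abs_of_nonneg (by positivity)]
    nlinarith
  rcases a with i | (_ | _ | _ | _ | i | i | i | i)
  · exact hmul (by linarith [(hx i).1]) (hx i).2
  · simpa [operandValue] using hq.le
  · simp only [operandValue, abs_le]; constructor <;> linarith
  · simp only [operandValue, abs_le]; constructor <;> linarith
  · simp only [operandValue, abs_le]; constructor <;> linarith
  · have := hmul (s := x i - 1 / 2) (by linarith [(hx i).1]) (by linarith [(hx i).2])
    convert this using 2
    simp only [operandValue]; ring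
  · have := hmul (s := 2 - x i) (by linarith [(hx i).2]) (by linarith [(hx i).1])
    convert this using 2
    simp only [operandValue]; ring
  · exact hmul (Real.sqrt_nonneg _) (Real.sqrt_le_iff.2 ⟨by norm_num, by linarith [(hx i).2]⟩)
  · exact hmul (Real.sqrt_nonneg _) (Real.sqrt_le_iff.2 ⟨by norm_num, by linarith [(hx i).1]⟩)

theorem abs_value_le {q : ℝ} (hq : q ∈ Set.Ioc (0 : ℝ) (1 / 2)) {x : Fin n → ℝ}
    (hx : ∀ i, x i ∈ Set.Icc (1 / 2 : ℝ) 2) (v : ShrunkAux n) : |value q x v| ≤ 6 * q := by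
  obtain ⟨hq0, hq1⟩ := hq
  have hop := abs_operandValue_le hq0 hx
  have hmul (a b) : |operandValue q x a * operandValue q x b| ≤ 2 * q := by
    rw [abs_mul]
    nlinarith [mul_le_mul (hop a) (hop b) (abs_nonneg _) (by linarith)]
  rcases v with a | ⟨a, b⟩ | ⟨a, b⟩ | ⟨a, b⟩
  · exact (hop _).trans (by linarith)
  · exact (abs_add_le _ _).trans (by linarith [hop a, hop b])
  · exact (abs_add_three _ _ _).trans (by linarith [hop a, hop b, hmul a b])
  · exact (hmul a b).trans (by linarith)

theorem consistent_value (q : ℝ) {x : Fin n → ℝ} (hx : ∀ i, x i ∈ Set.Icc (1 / 2 : ℝ) 2) :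
    Consistent q (Sum.elim (fun i => q * x i) (value q x)) := by
  have hop (a : ShrunkOperand n) :
      Sum.elim (fun i => q * x i) (value q x) (ofOperand a) = operandValue q x a := by
    cases a <;> rfl
  refine ⟨rfl, rfl, rfl, rfl, fun _ => rfl, fun _ => rfl, fun i => ?_, fun i => ?_, ?_, ?_, ?_⟩
  · change (q * √(x i - 1 / 2)) ^ 2 = q * (q * x i - q / 2)
    rw [mul_pow, Real.sq_sqrt (by linarith [(hx i).1])]
    ring
  · change (q * √(2 - x i)) ^ 2 = q * (2 * q - q * x i)
    rw [mul_pow, Real.sq_sqrt (by linarith [(hx i).2])]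
    ring
  all_goals
    intro a b
    rw [hop, hop]
    rfl

end ShrunkAux

/-- for each `n` there is `m` such that for every `q ∈ (0, 1/2]` and every
`V ⊆ [1/2, 2]^n` that is an intersection of finitely many sets of the form
`{x ∈ [1/2, 2]^n : (x_{i₁}, x_{i₂}, x_{i₃}, x_{i₄}) ∈ c}` with `c ∈ 𝒞(q)`, there is a
set `V′ ⊆ ℝ^{n+m}` cut out by constraints of the forms `αᵢ + αⱼ = α_k`,
`(1+αᵢ)(1+αⱼ) = 1+α_k` and `αᵢ = q`, with exactly one of the last form, such that every
`x ∈ V` extends to some `(q·x, y) ∈ V′` with `y ∈ [−6q, 6q]^m`, and every `(x, y) ∈ V′`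
has `q⁻¹·x ∈ V`. -/
theorem constraint_set_shrinking (n : ℕ) :
    ∃ m : ℕ, ∀ q : ℝ, q ∈ Set.Ioc (0 : ℝ) (1/2) →
      ∀ V : Set (Fin n → ℝ),
        (∃ L : List ((Fin 4 → Fin n) × Set (Fin 4 → ℝ)),
          (∀ p ∈ L, p.2 ∈ CqSets q) ∧
          V = {x | (∀ j, x j ∈ Set.Icc (1/2 : ℝ) 2) ∧
                ∀ p ∈ L, (fun t => x (p.1 t)) ∈ p.2}) →
        ∃ (cs : List (Shrunk (Fin n ⊕ Fin m))) (V' : Set ((Fin n ⊕ Fin m) → ℝ)),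
          cs.countP Shrunk.isConst = 1 ∧
          V' = {α | ∀ c ∈ cs, Shrunk.Sat q α c} ∧
          (∀ x ∈ V, ∃ y : Fin m → ℝ,
            (∀ j, y j ∈ Set.Icc (-(6 * q)) (6 * q)) ∧
            Sum.elim (fun i => q * x i) y ∈ V') ∧
          (∀ α ∈ V', (fun i : Fin n => q⁻¹ * α (Sum.inl i)) ∈ V) := by
  refine ⟨Fintype.card (ShrunkAux n), fun q hq V ⟨L, hL, hV⟩ => ?_⟩
  have hq0 : 0 < q := hq.1
  let e := Fintype.equivFin (ShrunkAux n)
  let f : Fin n ⊕ ShrunkAux n → Fin n ⊕ Fin (Fintype.card (ShrunkAux n)) := Sum.map id e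
  have : Nonempty (Shrunk (Fin n ⊕ ShrunkAux n)) := ⟨.const (ShrunkAux.var .unit)⟩
  choose! g hgc hg using fun (p : (Fin 4 → Fin n) × Set (Fin 4 → ℝ)) (hp : p ∈ L) =>
    ShrunkAux.exists_shrunk_of_mem_CqSets hq0 p.1 (hL p hp)
  let cs := Shrunk.const (ShrunkAux.var .unit) :: (ShrunkAux.baseConstraints n ++ L.map g)
  have hsat (α : Fin n ⊕ ShrunkAux n → ℝ) : (∀ c ∈ cs, c.Sat q α) ↔
      ShrunkAux.Consistent q α ∧
        ∀ p ∈ L, (fun k => q⁻¹ * α (.inl (p.1 k))) ∈ p.2 := by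
    simp only [cs, List.forall_mem_cons, List.forall_mem_append, List.forall_mem_map, ← and_assoc]
    rw [show Shrunk.Sat q α (.const (ShrunkAux.var .unit)) ↔ α (ShrunkAux.var .unit) = q from
      Iff.rfl, ← ShrunkAux.consistent_iff]
    exact and_congr_right fun h => forall₂_congr fun p hp => hg p hp α h
  refine ⟨cs.map (Shrunk.map f), _, ?_, rfl, fun x hx => ?_, fun α hα => ?_⟩
  · have hzero : (ShrunkAux.baseConstraints n ++ L.map g).countP Shrunk.isConst = 0 := by
      rw [List.countP_eq_zero]
      intro c hc
      rw [Bool.not_eq_true]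
      rcases List.mem_append.1 hc with hc | hc
      · exact ShrunkAux.isConst_of_mem_baseConstraints hc
      · obtain ⟨p, hp, rfl⟩ := List.mem_map.1 hc
        exact hgc p hp
    rw [List.countP_map, show Shrunk.isConst ∘ Shrunk.map f = Shrunk.isConst from
      funext (Shrunk.isConst_map f), List.countP_cons, hzero]
    rfl
  · rw [hV] at hx
    obtain ⟨hx, hxL⟩ := hx
    refine ⟨ShrunkAux.value q x ∘ e.symm, fun j => abs_le.1 (ShrunkAux.abs_value_le hq hx _), ?_⟩
    have hcomp : Sum.elim (fun i => q * x i) (ShrunkAux.value q x ∘ e.symm) ∘ f =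
        Sum.elim (fun i => q * x i) (ShrunkAux.value q x) := by
      ext (i | v) <;> simp [f]
    simp only [Set.mem_ofPred_eq, List.forall_mem_map, Shrunk.sat_map, hcomp]
    refine (hsat _).2 ⟨ShrunkAux.consistent_value q hx, fun p hp => ?_⟩
    simpa [hq0.ne'] using hxL p hp
  · simp only [Set.mem_ofPred_eq, List.forall_mem_map, Shrunk.sat_map] at hα
    obtain ⟨hc, hαL⟩ := (hsat _).1 hα
    rw [hV]
    exact ⟨fun i => hc.mem_Icc hq0 i, hαL⟩
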